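/- arXiv:1505.02390 — 2 statements merged into one kernel-verified Lean document; each statement's English description precedes it below -/
import Mathlib

section
/- Suppose N > 4nβ + 1. Then the number of ordered pairs ((p,i),(q,j)) with (p,i), (q,j) ∈ {0,…,n} × {1,…,N}, (p,i) ≠ (q,j), and pa(p,i) ∩ pa(q,j) = ∅ is at least N·(n+1)²·(N − 4nβ − 1). -/
open scoped Classical

/-- Cyclic graph distance on `Fin N`: `Δ(i,j) = min_{ℓ ∈ ℤ} |i - j + ℓ·N|`. -/
noncomputable def cdistF (N : ℕ) (i j : Fin N) : ℕ :=
  sInf {d : ℕ | ∃ ℓ : ℤ, (d : ℤ) = |((i : ℕ) : ℤ) - ((j : ℕ) : ℤ) + ℓ * (N : ℤ)|}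

/-- The parent set `pa(p,i) = {(q,j) : q < p, (α^{p-q})^{ij} > 0}`. -/
noncomputable def paSet {N : ℕ} (α : Matrix (Fin N) (Fin N) ℝ) (x : ℕ × Fin N) :
    Finset (ℕ × Fin N) :=
  (Finset.range x.1 ×ˢ (Finset.univ : Finset (Fin N))).filter
    fun y => 0 < (α ^ (x.1 - y.1)) x.2 y.2

/-- `i` and `j` are congruent modulo `N` up to an error of size at most `d`. -/
def CycNear {N : ℕ} (d : ℕ) (i j : Fin N) : Prop :=
  ∃ ℓ : ℤ, |((i : ℕ) : ℤ) - ((j : ℕ) : ℤ) + ℓ * (N : ℤ)| ≤ d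

theorem CycNear.trans {N d e : ℕ} {i j k : Fin N} (h : CycNear d i j) (h' : CycNear e j k) :
    CycNear (d + e) i k := by
  obtain ⟨a, ha⟩ := h
  obtain ⟨b, hb⟩ := h'
  refine ⟨a + b, ?_⟩
  rw [abs_le] at *
  push_cast
  constructor <;> linarith [ha.1, ha.2, hb.1, hb.2]

theorem CycNear.symm {N d : ℕ} {i j : Fin N} (h : CycNear d i j) : CycNear d j i := by
  obtain ⟨a, ha⟩ := h
  refine ⟨-a, ?_⟩
  rw [abs_le] at *
  constructor <;> linarith [ha.1, ha.2]

theorem CycNear.mono {N d e : ℕ} {i j : Fin N} (hde : d ≤ e) (h : CycNear d i j) :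
    CycNear e i j := by
  obtain ⟨a, ha⟩ := h
  exact ⟨a, ha.trans (by exact_mod_cast hde)⟩

theorem cycNear_refl {N : ℕ} (d : ℕ) (i : Fin N) : CycNear d i i :=
  ⟨0, by simp⟩

theorem cycNear_cdistF {N : ℕ} (i j : Fin N) : CycNear (cdistF N i j) i j := by
  have hne : {d : ℕ | ∃ ℓ : ℤ,
      (d : ℤ) = |((i : ℕ) : ℤ) - ((j : ℕ) : ℤ) + ℓ * (N : ℤ)|}.Nonempty :=
    ⟨(((i : ℕ) : ℤ) - ((j : ℕ) : ℤ)).natAbs, 0, by simp⟩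
  obtain ⟨ℓ, hℓ⟩ := Nat.sInf_mem hne
  exact ⟨ℓ, hℓ.ge⟩

theorem cycNear_of_pow_ne_zero {N β : ℕ} {α : Matrix (Fin N) (Fin N) ℝ}
    (hband : ∀ i j : Fin N, β < cdistF N i j → α i j = 0) (k : ℕ) (i j : Fin N)
    (h : (α ^ k) i j ≠ 0) : CycNear (k * β) i j := by
  induction k generalizing j with
  | zero =>
    have hij : i = j := by
      by_contra hij
      exact h (by simp [hij])
    exact hij ▸ cycNear_refl _ _
  | succ k ih =>
    rw [pow_succ, Matrix.mul_apply] at h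
    obtain ⟨l, -, hl⟩ := Finset.exists_ne_zero_of_sum_ne_zero h
    have hαl : cdistF N l j ≤ β := not_lt.1 fun hlt => right_ne_zero_of_mul hl (hband l j hlt)
    rw [Nat.succ_mul]
    exact (ih l (left_ne_zero_of_mul hl)).trans ((cycNear_cdistF l j).mono hαl)

theorem cycNear_of_paSet_inter_ne_empty {N n β p q : ℕ} {α : Matrix (Fin N) (Fin N) ℝ}
    (hband : ∀ i j : Fin N, β < cdistF N i j → α i j = 0) (hp : p ≤ n) (hq : q ≤ n)
    {i j : Fin N} (h : paSet α (p, i) ∩ paSet α (q, j) ≠ ∅) :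
    CycNear (2 * n * β) i j := by
  obtain ⟨⟨r, l⟩, hr⟩ := Finset.nonempty_iff_ne_empty.2 h
  simp only [paSet, Finset.mem_inter, Finset.mem_filter] at hr
  have bound : ∀ s ≤ n, (s - r) * β ≤ n * β := fun s hs =>
    Nat.mul_le_mul_right _ ((Nat.sub_le s r).trans hs)
  have h₁ := (cycNear_of_pow_ne_zero hband _ _ _ hr.1.2.ne').mono (bound p hp)
  have h₂ := (cycNear_of_pow_ne_zero hband _ _ _ hr.2.2.ne').mono (bound q hq)
  exact (h₁.trans h₂.symm).mono (by linarith)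

theorem card_cycNear_le {N : ℕ} (d : ℕ) (i : Fin N) :
    (Finset.univ.filter fun j : Fin N => CycNear d i j).card ≤ 2 * d + 1 := by
  have hN : 0 < N := i.pos
  have hsub : (Finset.univ.filter fun j : Fin N => CycNear d i j) ⊆
      (Finset.Icc (-(d : ℤ)) d).image fun m : ℤ =>
        (⟨((((i : ℕ) : ℤ) - m) % N).toNat, by
          have := Int.emod_lt_of_pos (((i : ℕ) : ℤ) - m) (Int.natCast_pos.2 hN)
          omega⟩ : Fin N) := by
    intro j hj
    obtain ⟨ℓ, hℓ⟩ := (Finset.mem_filter.1 hj).2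
    refine Finset.mem_image.2 ⟨_, Finset.mem_Icc.2 (abs_le.1 hℓ), Fin.ext ?_⟩
    have hmod : (((i : ℕ) : ℤ) - (((i : ℕ) : ℤ) - ((j : ℕ) : ℤ) + ℓ * (N : ℤ))) % N =
        ((j : ℕ) : ℤ) := by
      rw [show ((i : ℕ) : ℤ) - (((i : ℕ) : ℤ) - ((j : ℕ) : ℤ) + ℓ * (N : ℤ)) =
        ((j : ℕ) : ℤ) + (-ℓ) * N by ring, Int.add_mul_emod_self_right]
      exact Int.emod_eq_of_lt (by positivity) (by exact_mod_cast j.isLt)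
    simp [hmod]
  refine (Finset.card_le_card hsub).trans (Finset.card_image_le.trans ?_)
  rw [Int.card_Icc]
  omega

theorem le_card_not_cycNear {N : ℕ} (d : ℕ) (i : Fin N) :
    N - 2 * d - 1 ≤ (Finset.univ.filter fun j : Fin N => ¬ CycNear d i j).card := by
  have h := Finset.card_filter_add_card_filter_not (s := (Finset.univ : Finset (Fin N)))
    (fun j => CycNear d i j)
  have h' := card_cycNear_le d i
  rw [Finset.card_univ, Fintype.card_fin] at h
  omega

/-- If `N > 4nβ + 1`, then the number of ordered pairs `((p,i),(q,j))` of distinct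
time–index pairs with disjoint parent sets is at least `N(n+1)²(N - 4nβ - 1)`. -/
theorem many_pairs_with_disjoint_parents (N n β : ℕ) (hβ : 1 ≤ β) (hN : 4 * n * β + 1 < N)
    (α : Matrix (Fin N) (Fin N) ℝ)
    (hα0 : ∀ i j, 0 ≤ α i j)
    (hband : ∀ i j : Fin N, β < cdistF N i j → α i j = 0) :
    N * (n + 1) ^ 2 * (N - 4 * n * β - 1) ≤
      (((Finset.range (n + 1) ×ˢ (Finset.univ : Finset (Fin N))) ×ˢ
         (Finset.range (n + 1) ×ˢ (Finset.univ : Finset (Fin N)))).filter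
        fun x => x.1 ≠ x.2 ∧ paSet α x.1 ∩ paSet α x.2 = ∅).card := by
  rw [Finset.card_filter, Finset.sum_product]
  have inner : ∀ x ∈ Finset.range (n + 1) ×ˢ (Finset.univ : Finset (Fin N)),
      (n + 1) * (N - 4 * n * β - 1) ≤
        ∑ y ∈ Finset.range (n + 1) ×ˢ (Finset.univ : Finset (Fin N)),
          if x ≠ y ∧ paSet α x ∩ paSet α y = ∅ then 1 else 0 := by
    rintro ⟨p, i⟩ hx
    have hp : p ≤ n := Nat.lt_succ_iff.1 (Finset.mem_range.1 (Finset.mem_product.1 hx).1)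
    rw [Finset.sum_product]
    refine le_trans (by simp) (Finset.card_nsmul_le_sum _ _ (N - 4 * n * β - 1) fun q hq => ?_)
    have hq' : q ≤ n := Nat.lt_succ_iff.1 (Finset.mem_range.1 hq)
    rw [← Finset.card_filter]
    have hd : N - 4 * n * β - 1 = N - 2 * (2 * n * β) - 1 := by ring_nf
    rw [hd]
    refine (le_card_not_cycNear (2 * n * β) i).trans (Finset.card_le_card ?_)
    refine Finset.monotone_filter_right _ fun j _ hj => ⟨fun h => hj ?_, ?_⟩
    · rw [Prod.mk.injEq] at h
      exact h.2 ▸ cycNear_refl _ _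
    · by_contra h
      exact hj (cycNear_of_paSet_inter_ne_empty hband hp hq' h)
  refine le_trans (le_of_eq ?_) (Finset.card_nsmul_le_sum _ _ _ inner)
  rw [Finset.card_product, Finset.card_range, Finset.card_univ, Fintype.card_fin, smul_eq_mul]
  ring
end

section
/- Set β := M − 1 + θ. For every m ≥ 1 with N = Mm ≥ 2β + 1 and all i, j ∈ ℤ: α_∞^{ij} = α_N^{(i cmod N),(j cmod N)} · 𝟙[|i − j| ≤ β]. (That is, the LEPF matrices satisfy the similarity Assumption (2.4).) -/
/-- `(y cmod x) = y - ⌊(y-1)/x⌋ · x`. -/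
def cmod (y x : ℤ) : ℤ := y - ((y - 1).fdiv x) * x

/-- The LEPF limiting matrix `α_∞^{ij} = M⁻¹·𝟙[⌊(i-1)/M⌋ = ⌊(j-θ-1)/M⌋]`. -/
noncomputable def lepfInf (M θ i j : ℤ) : ℝ :=
  if (i - 1).fdiv M = (j - θ - 1).fdiv M then (M : ℝ)⁻¹ else 0

/-- The LEPF matrix `α_N^{ij} = M⁻¹·𝟙[⌊(i-1)/M⌋ = ⌊((j-θ) cmod N - 1)/M⌋]`. -/
noncomputable def lepfN (M θ N i j : ℤ) : ℝ :=
  if (i - 1).fdiv M = ((cmod (j - θ) N) - 1).fdiv M then (M : ℝ)⁻¹ else 0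

theorem cmod_sub_one (y x : ℤ) (hx : 0 ≤ x) : cmod y x - 1 = (y - 1) % x := by
  rw [cmod, Int.fdiv_eq_ediv_of_nonneg _ hx, Int.emod_def]
  ring

theorem cmod_cmod_sub_sub_one (y t x : ℤ) (hx : 0 ≤ x) :
    cmod (cmod y x - t) x - 1 = (y - t - 1) % x := by
  rw [cmod_sub_one _ _ hx, cmod, show y - (y - 1).fdiv x * x - t - 1
    = y - t - 1 - (y - 1).fdiv x * x by ring, Int.sub_mul_emod_self_right]

theorem emod_mul_ediv (a M m : ℤ) (hM : 0 < M) : a % (M * m) / M = a / M % m := by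
  rw [Int.emod_def, mul_assoc, Int.sub_mul_ediv_left _ _ hM.ne',
    ← Int.ediv_ediv_of_nonneg hM.le, ← Int.emod_def]

theorem ediv_eq_ediv_iff_emod_eq_and_abs_le (a b M θ m : ℤ) (hM : 0 < M) (hθ : 0 ≤ θ)
    (hbig : 2 * (M - 1 + θ) + 1 ≤ M * m) :
    a / M = b / M ↔ a / M % m = b / M % m ∧ |a - b - θ| ≤ M - 1 + θ := by
  have ha := Int.mul_ediv_add_emod a M
  have hb := Int.mul_ediv_add_emod b M
  have ha0 := Int.emod_nonneg a hM.ne'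
  have hb0 := Int.emod_nonneg b hM.ne'
  have ha1 := Int.emod_lt_of_pos a hM
  have hb1 := Int.emod_lt_of_pos b hM
  constructor
  · intro h
    rw [h] at ha
    refine ⟨by rw [h], abs_le.2 ⟨by linarith, by linarith⟩⟩
  · rintro ⟨h, habs⟩
    obtain ⟨h1, h2⟩ := abs_le.1 habs
    obtain ⟨c, hc⟩ := Int.ModEq.dvd h
    have hcN : M * (b / M) - M * (a / M) = M * m * c := by
      rw [← mul_sub, hc, mul_assoc]
    have hc0 : c = 0 := by
      have : c < 1 := by
        by_contra! h'
        nlinarith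
      have : -1 < c := by
        by_contra! h'
        nlinarith
      omega
    rw [hc0, mul_zero] at hc
    omega

/-- The LEPF matrices satisfy the similarity Assumption (2.4): with `β = M - 1 + θ`,
for `N = Mm ≥ 2β + 1`, `α_∞^{ij} = α_N^{(i cmod N),(j cmod N)} · 𝟙[|i-j| ≤ β]`. -/
theorem lepf_similarity (M θ : ℤ) (hM : 2 ≤ M) (hθ1 : 1 ≤ θ) (hθ2 : θ ≤ M - 1)
    (m N : ℤ) (hm : 1 ≤ m) (hN : N = M * m) (hNbig : 2 * (M - 1 + θ) + 1 ≤ N) :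
    ∀ i j : ℤ, lepfInf M θ i j =
      lepfN M θ N (cmod i N) (cmod j N) * (if |i - j| ≤ M - 1 + θ then 1 else 0) := by
  intro i j
  have hM0 : 0 < M := by omega
  have hN0 : 0 ≤ N := by omega
  subst hN
  have key := ediv_eq_ediv_iff_emod_eq_and_abs_le (i - 1) (j - θ - 1) M θ m hM0 (by omega) hNbig
  rw [show i - 1 - (j - θ - 1) - θ = i - j by ring] at key
  simp only [lepfInf, lepfN, cmod_sub_one i _ hN0, cmod_cmod_sub_sub_one j θ _ hN0,
    Int.fdiv_eq_ediv_of_nonneg _ hM0.le, emod_mul_ediv _ _ _ hM0, key, ite_and, mul_ite,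
    mul_one, mul_zero]
  split_ifs <;> rfl
end
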